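/- For 0 < c < 1, the function F_c : [0,1] → ℝ defined by F_c(x) = (c x² + (1 − c)(1 − x)² · c x/(c + x)) / (c x + (1 − c)(1 − x)²) satisfies: (a) F_c is infinitely differentiable on [0,1] (it is the restriction of a C^∞ function on an open neighborhood of [0,1], since c x + (1 − c)(1 − x)² > 0 and c + x > 0 there); (b) F_c is strictly increasing on [0,1]; (c) F_c(0) = 0 and F_c(1) = 1; (d) the one-sided derivatives satisfy F_c′(0⁺) = 1 and F_c′(1⁻) = 1. (Lemma 4.3 (a)–(d).) -/

import Mathlib

open Set

/-- The function `F_c` of the Várkonyi–Domokos construction. -/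
noncomputable def Fc (c x : ℝ) : ℝ :=
  (c * x^2 + (1 - c) * (1 - x)^2 * (c * x / (c + x))) / (c * x + (1 - c) * (1 - x)^2)

theorem Fc_denom_pos {c x : ℝ} (hc0 : 0 < c) (hc1 : c < 1) (hx : 0 ≤ x) :
    0 < c * x + (1 - c) * (1 - x) ^ 2 := by
  have h1 : 0 < 1 - c := sub_pos.2 hc1
  rcases hx.eq_or_lt with rfl | hx
  · simpa using h1
  · positivity

/-- `F_c` is a weighted mean of `c x / (c + x)` and `x`, written here as a perturbation of the
former. -/
theorem Fc_eq_add_mul {c x : ℝ} (hc0 : 0 < c) (hc1 : c < 1) (hx : 0 ≤ x) :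
    Fc c x = c * x / (c + x) +
      c * x / (c * x + (1 - c) * (1 - x) ^ 2) * (x ^ 2 / (c + x)) := by
  have hD := (Fc_denom_pos hc0 hc1 hx).ne'
  have hs : c + x ≠ 0 := by positivity
  unfold Fc
  field_simp
  ring

theorem strictMonoOn_Fc {c : ℝ} (hc0 : 0 < c) (hc1 : c < 1) :
    StrictMonoOn (Fc c) (Icc 0 1) := by
  rintro x ⟨hx0, hx1⟩ y ⟨hy0, hy1⟩ hxy
  rw [Fc_eq_add_mul hc0 hc1 hx0, Fc_eq_add_mul hc0 hc1 hy0]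
  have hDx := Fc_denom_pos hc0 hc1 hx0
  have hDy := Fc_denom_pos hc0 hc1 hy0
  have hsx : 0 < c + x := by positivity
  have hsy : 0 < c + y := by positivity
  have hg : c * x / (c + x) < c * y / (c + y) := by
    rw [div_lt_div_iff₀ hsx hsy]
    nlinarith [mul_pos (mul_pos hc0 hc0) (sub_pos.2 hxy)]
  have hw : c * x / (c * x + (1 - c) * (1 - x) ^ 2) ≤
      c * y / (c * y + (1 - c) * (1 - y) ^ 2) := by
    rw [div_le_div_iff₀ hDx hDy]
    have hxy1 : 0 ≤ 1 - x * y := by nlinarith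
    have := mul_nonneg (mul_nonneg hc0.le (sub_pos.2 hc1).le)
      (mul_nonneg (sub_pos.2 hxy).le hxy1)
    linear_combination this
  have hh : x ^ 2 / (c + x) ≤ y ^ 2 / (c + y) := by
    rw [div_le_div_iff₀ hsx hsy]
    have : 0 ≤ (y - x) * (c * (x + y) + x * y) :=
      mul_nonneg (sub_pos.2 hxy).le (by positivity)
    linear_combination this
  exact add_lt_add_of_lt_of_le hg (mul_le_mul hw hh (by positivity) (by positivity))

theorem contDiffOn_Fc (c : ℝ) {n : WithTop ℕ∞} :
    ContDiffOn ℝ n (Fc c) {x | c + x ≠ 0 ∧ c * x + (1 - c) * (1 - x) ^ 2 ≠ 0} := by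
  unfold Fc
  refine ContDiffOn.div (ContDiffOn.add (by fun_prop) (ContDiffOn.mul (by fun_prop)
    (ContDiffOn.div (by fun_prop) (by fun_prop) fun x hx => hx.1))) (by fun_prop) fun x hx => hx.2

theorem hasDerivAt_Fc {c x : ℝ} (hs : c + x ≠ 0) (hD : c * x + (1 - c) * (1 - x) ^ 2 ≠ 0) :
    HasDerivAt (Fc c)
      (((2 * c * x - 2 * (1 - c) * (1 - x) * (c * x / (c + x)) +
        (1 - c) * (1 - x) ^ 2 * (c ^ 2 / (c + x) ^ 2)) * (c * x + (1 - c) * (1 - x) ^ 2) -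
        (c * x ^ 2 + (1 - c) * (1 - x) ^ 2 * (c * x / (c + x))) *
        (c - 2 * (1 - c) * (1 - x))) / (c * x + (1 - c) * (1 - x) ^ 2) ^ 2) x := by
  have hid := hasDerivAt_id' x
  have hv := ((hid.const_sub 1).fun_pow 2).const_mul (1 - c)
  have hg := (hid.const_mul c).fun_div (hid.const_add c) hs
  have hN := ((hid.fun_pow 2).const_mul c).fun_add (hv.fun_mul hg)
  refine (hN.fun_div ((hid.const_mul c).fun_add hv) hD).congr_deriv ?_
  congr 1
  push_cast
  ring

/-- Lemma 4.3 (a)-(d): for `0 < c < 1`, `F_c` is smooth on a neighborhood of `[0,1]`,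
strictly increasing on `[0,1]`, satisfies `F_c(0) = 0`, `F_c(1) = 1`, and has one-sided
derivatives `F_c′(0⁺) = F_c′(1⁻) = 1`. -/
theorem stmt_9 (c : ℝ) (hc0 : 0 < c) (hc1 : c < 1) :
    (∃ U : Set ℝ, IsOpen U ∧ Icc (0:ℝ) 1 ⊆ U ∧ ContDiffOn ℝ (⊤ : ℕ∞) (Fc c) U) ∧
    StrictMonoOn (Fc c) (Icc 0 1) ∧
    (Fc c 0 = 0 ∧ Fc c 1 = 1) ∧
    (HasDerivWithinAt (Fc c) 1 (Icc 0 1) 0 ∧ HasDerivWithinAt (Fc c) 1 (Icc 0 1) 1) := by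
  have h1 : 1 - c ≠ 0 := (sub_pos.2 hc1).ne'
  have hs : ∀ x : ℝ, 0 ≤ x → c + x ≠ 0 := fun x hx => by positivity
  have hD := fun (x : ℝ) (hx : 0 ≤ x) => (Fc_denom_pos hc0 hc1 hx).ne'
  refine ⟨⟨{x | c + x ≠ 0 ∧ c * x + (1 - c) * (1 - x) ^ 2 ≠ 0}, ?_,
      fun x hx => ⟨hs x hx.1, hD x hx.1⟩, contDiffOn_Fc c⟩,
    strictMonoOn_Fc hc0 hc1, ⟨by simp [Fc], by simp [Fc, hc0.ne']⟩, ?_, ?_⟩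
  · exact (isOpen_ne_fun (by fun_prop) (by fun_prop)).inter
      (isOpen_ne_fun (by fun_prop) (by fun_prop))
  · refine ((hasDerivAt_Fc (hs 0 le_rfl) (hD 0 le_rfl)).congr_deriv ?_).hasDerivWithinAt
    simp only [mul_zero, add_zero, zero_add, sub_zero, zero_div]
    field_simp
    ring
  · refine ((hasDerivAt_Fc (hs 1 zero_le_one) (hD 1 zero_le_one)).congr_deriv ?_).hasDerivWithinAt
    have hc : c ≠ 0 := hc0.ne'
    simp only [sub_self, mul_one, mul_zero, zero_mul, ne_eq, OfNat.ofNat_ne_zero,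
      not_false_eq_true, zero_pow, add_zero, sub_zero, one_pow]
    field_simp
    ring
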